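/- Let N ≥ 2 be an integer, 0 < s < 1 and p > 1 with ps < N. For every η ≥ 0 with η(p−1) < N, the integral Θ(η) = ∫_1^∞ K(σ)(σ^η−1)^{p−1}(σ^{N−1−η(p−1)} − σ^{ps−1}) dσ converges. Moreover Θ(0) = 0, and Θ attains its maximum at η = (N−ps)/p with Θ((N−ps)/p) = Λ_{N,p,s}; that is, Θ(η) ≤ Λ_{N,p,s} for every η ≥ 0 with η(p−1) < N. -/

import Mathlib

open MeasureTheory Real Set Filter Metric
open scoped ENNReal Topology NNReal

noncomputable section

abbrev Euc (N : ℕ) := EuclideanSpace ℝ (Fin N)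

/-- The spherical kernel `K(σ)`. -/
def sphereKernel (N : ℕ) (p s : ℝ) (e : Euc N) (σ : ℝ) : ℝ :=
  ∫ y in Metric.sphere (0 : Euc N) 1, ‖e - σ • y‖ ^ (-((N : ℝ) + p * s)) ∂ μH[(N : ℝ) - 1]

/-- The optimal fractional Hardy constant `Λ_{N,p,s}`. -/
def hardyConst (N : ℕ) (p s : ℝ) (e : Euc N) : ℝ :=
  ∫ σ in Set.Ioo (0:ℝ) 1,
    σ ^ (p * s - 1) * (1 - σ ^ (((N : ℝ) - p * s) / p)) ^ p * sphereKernel N p s e σ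

/-- The integrand of `Θ(η)`. -/
def thetaIntegrand (N : ℕ) (p s η : ℝ) (e : Euc N) (σ : ℝ) : ℝ :=
  sphereKernel N p s e σ * (σ ^ η - 1) ^ (p - 1) *
    (σ ^ ((N : ℝ) - 1 - η * (p - 1)) - σ ^ (p * s - 1))

/-- `Θ(η) = ∫_1^∞ K(σ)(σ^η-1)^{p-1}(σ^{N-1-η(p-1)} - σ^{ps-1}) dσ`. -/
def theta (N : ℕ) (p s η : ℝ) (e : Euc N) : ℝ :=
  ∫ σ in Set.Ioi (1:ℝ), thetaIntegrand N p s η e σ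

theorem ahlfors_hemisphere {N : ℕ} (e : Euc N) (he : ‖e‖ = 1) :
    ∃ C : ℝ, 0 ≤ C ∧ ∀ r : ℝ, 0 ≤ r →
      μH[(N : ℝ) - 1] {y : Euc N | ‖y‖ = 1 ∧ 0 ≤ inner ℝ e y ∧ ‖y - e‖ ≤ r} ≤
        ENNReal.ofReal (C * r ^ ((N : ℝ) - 1)) := by
  have hN : 1 ≤ N := by
    rcases Nat.eq_zero_or_pos N with rfl | h
    · have : e = 0 := Subsingleton.elim _ _
      simp [this] at he
    · exact h
  set v : Euc N := -e with hv
  have hv1 : ‖v‖ = 1 := by simp [hv, he]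
  let V := (ℝ ∙ v)ᗮ
  have hfr : Module.finrank ℝ V = N - 1 := by
    have : Fact (Module.finrank ℝ (Euc N) = (N - 1) + 1) := ⟨by simp; omega⟩
    exact Submodule.finrank_orthogonal_span_singleton (by rw [← norm_ne_zero_iff, hv1]; simp)
  have hd : ((Module.finrank ℝ V : ℕ) : ℝ) = (N : ℝ) - 1 := by rw [hfr]; push_cast [hN]; ring
  let g : V → Euc N := fun w => stereoInvFunAux v (w : Euc N)
  have hg : ContDiff ℝ 1 g := contDiff_stereoInvFunAux.comp V.subtypeL.contDiff
  obtain ⟨K, hK⟩ := (hg.locallyLipschitz.locallyLipschitzOn (s := closedBall (0:V) 2)).exists_lipschitzOnWith_of_compact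
    (isCompact_closedBall _ _)
  let B := μH[(N : ℝ) - 1] (ball (0 : V) 1)
  have hB : B ≠ ∞ := by
    simp only [B, ← hd]
    exact (measure_ball_lt_top).ne
  have hN0 : 0 ≤ (N : ℝ) - 1 := by rw [← hd]; positivity
  refine ⟨(K : ℝ) ^ ((N : ℝ) - 1) * (2 ^ ((N : ℝ) - 1) * B.toReal), by positivity, fun r hr => ?_⟩
  have hsub : {y : Euc N | ‖y‖ = 1 ∧ 0 ≤ inner ℝ e y ∧ ‖y - e‖ ≤ r} ⊆
      g '' (closedBall 0 2 ∩ closedBall 0 (2 * r)) := by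
    rintro y ⟨hy1, hy2, hy3⟩
    have hyv : y ≠ v := by
      rintro rfl
      simp [hv, he] at hy2
      linarith
    refine ⟨stereoToFun v y, ?_, ?_⟩
    · have hin : inner ℝ v y = - inner ℝ e y := by simp [hv]
      have hc : |2 / (1 - inner ℝ v y)| ≤ 2 := by
        rw [hin, abs_of_nonneg (by apply div_nonneg <;> linarith), div_le_iff₀ (by linarith)]
        linarith
      have h1 : ‖V.orthogonalProjectionOnto y‖ ≤ 1 := hy1 ▸ V.norm_orthogonalProjectionOnto_apply_le y
      have h2 : ‖V.orthogonalProjectionOnto y‖ ≤ r := by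
        have : V.orthogonalProjectionOnto y = V.orthogonalProjectionOnto (y - e) := by
          have : V.orthogonalProjectionOnto v = 0 :=
            Submodule.orthogonalProjectionOnto_orthogonalComplement_singleton_eq_zero v
          rw [show y - e = y + v by simp [hv, sub_eq_add_neg], map_add, this, add_zero]
        rw [this]
        exact (V.norm_orthogonalProjectionOnto_apply_le _).trans hy3
      have h3 : ‖stereoToFun v y‖ ≤ 2 * ‖V.orthogonalProjectionOnto y‖ := by
        rw [stereoToFun_apply, norm_smul, innerSL_apply_apply, Real.norm_eq_abs]
        gcongr
      simp only [mem_inter_iff, mem_closedBall, dist_zero_right]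
      constructor <;> linarith
    · have := stereo_left_inv hv1 (x := ⟨y, by simpa using hy1⟩) hyv
      exact congrArg Subtype.val this
  calc _ ≤ μH[(N : ℝ) - 1] (g '' (closedBall 0 2 ∩ closedBall 0 (2 * r))) := measure_mono hsub
    _ ≤ (K : ℝ≥0∞) ^ ((N : ℝ) - 1) * μH[(N : ℝ) - 1] (closedBall (0 : V) 2 ∩ closedBall 0 (2 * r)) :=
        (hK.mono inter_subset_left).hausdorffMeasure_image_le hN0
    _ ≤ (K : ℝ≥0∞) ^ ((N : ℝ) - 1) * μH[(N : ℝ) - 1] (closedBall (0 : V) (2 * r)) := by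
        gcongr; exact inter_subset_right
    _ = (K : ℝ≥0∞) ^ ((N : ℝ) - 1) * (ENNReal.ofReal ((2 * r) ^ ((N : ℝ) - 1)) * B) := by
        congr 1
        simp only [B, ← hd]
        rw [Measure.addHaar_closedBall _ _ (by positivity), Real.rpow_natCast]
    _ = _ := by
        have hKr : (K : ℝ≥0∞) ^ ((N : ℝ) - 1) = ENNReal.ofReal ((K : ℝ) ^ ((N : ℝ) - 1)) := by
          rw [← ENNReal.ofReal_rpow_of_nonneg (by positivity) hN0, ENNReal.ofReal_coe_nnreal]
        conv_lhs => rw [hKr, ← ENNReal.ofReal_toReal hB]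
        rw [← ENNReal.ofReal_mul (by positivity), ← ENNReal.ofReal_mul (by positivity),
          Real.mul_rpow (by norm_num) hr]
        congr 1
        ring

theorem ahlfors_sphere {N : ℕ} (hN : 2 ≤ N) (e : Euc N) (he : ‖e‖ = 1) :
    ∃ C : ℝ, 0 ≤ C ∧ ∀ r : ℝ, 0 ≤ r →
      μH[(N : ℝ) - 1] (sphere (0 : Euc N) 1 ∩ closedBall e r) ≤
        ENNReal.ofReal (C * r ^ ((N : ℝ) - 1)) := by
  obtain ⟨C, hC, h⟩ := ahlfors_hemisphere e he
  obtain ⟨D, hD, h'⟩ := ahlfors_hemisphere (-e) (by simpa using he)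
  have hN0 : 0 ≤ (N : ℝ) - 1 := by
    have : (2 : ℝ) ≤ N := by exact_mod_cast hN
    linarith
  refine ⟨C + D * 2 ^ ((N : ℝ) - 1), by positivity, fun r hr => ?_⟩
  have hopp : ∀ y : Euc N, ‖y‖ = 1 → ‖y - e‖ ^ 2 = 2 - 2 * inner ℝ e y := by
    intro y hy
    rw [norm_sub_sq_real, hy, he, real_inner_comm]; ring
  rcases le_or_gt r 1 with hr1 | hr1
  · calc _ ≤ μH[(N : ℝ) - 1] {y : Euc N | ‖y‖ = 1 ∧ 0 ≤ inner ℝ e y ∧ ‖y - e‖ ≤ r} := by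
          apply measure_mono
          rintro y ⟨hy1, hy2⟩
          rw [mem_sphere_zero_iff_norm] at hy1
          rw [mem_closedBall, dist_eq_norm] at hy2
          refine ⟨hy1, ?_, hy2⟩
          nlinarith [hopp y hy1, norm_nonneg (y - e)]
      _ ≤ _ := h r hr
      _ ≤ _ := by
          gcongr
          have : 0 ≤ D * 2 ^ ((N : ℝ) - 1) := by positivity
          linarith
  · calc _ ≤ μH[(N : ℝ) - 1] ({y : Euc N | ‖y‖ = 1 ∧ 0 ≤ inner ℝ e y ∧ ‖y - e‖ ≤ r} ∪
            {y : Euc N | ‖y‖ = 1 ∧ 0 ≤ inner ℝ (-e) y ∧ ‖y - (-e)‖ ≤ 2}) := by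
          apply measure_mono
          rintro y ⟨hy1, hy2⟩
          rw [mem_sphere_zero_iff_norm] at hy1
          rw [mem_closedBall, dist_eq_norm] at hy2
          rcases le_total 0 (inner ℝ e y) with h0 | h0
          · exact Or.inl ⟨hy1, h0, hy2⟩
          · refine Or.inr ⟨hy1, by simpa using h0, ?_⟩
            calc _ ≤ ‖y‖ + ‖-e‖ := norm_sub_le _ _
              _ = 2 := by rw [norm_neg, hy1, he]; norm_num
      _ ≤ _ := measure_union_le _ _
      _ ≤ _ := add_le_add (h r hr) (h' 2 (by norm_num))
      _ = ENNReal.ofReal (C * r ^ ((N : ℝ) - 1) + D * 2 ^ ((N : ℝ) - 1)) := by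
          rw [ENNReal.ofReal_add] <;> positivity
      _ ≤ _ := by
          apply ENNReal.ofReal_le_ofReal
          have : 1 ≤ r ^ ((N : ℝ) - 1) := Real.one_le_rpow hr1.le hN0
          have : 0 ≤ D * 2 ^ ((N : ℝ) - 1) := by positivity
          nlinarith

theorem sphere_measure_lt_top {N : ℕ} (hN : 2 ≤ N) (e : Euc N) (he : ‖e‖ = 1) :
    μH[(N : ℝ) - 1] (sphere (0 : Euc N) 1) < ∞ := by
  obtain ⟨C, -, h⟩ := ahlfors_sphere hN e he
  refine lt_of_le_of_lt (measure_mono ?_) ((h 2 (by norm_num)).trans_lt ENNReal.ofReal_lt_top)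
  intro y hy
  refine ⟨hy, ?_⟩
  rw [mem_sphere_zero_iff_norm] at hy
  rw [mem_closedBall, dist_eq_norm]
  linarith [norm_sub_le y e]

theorem norm_sub_smul_sq {N : ℕ} {e y : Euc N} (he : ‖e‖ = 1) (hy : ‖y‖ = 1) (σ : ℝ) :
    ‖e - σ • y‖ ^ 2 = (σ - 1) ^ 2 + σ * ‖y - e‖ ^ 2 := by
  rw [norm_sub_sq_real, norm_sub_sq_real, norm_smul, inner_smul_right, hy, he, mul_one,
    Real.norm_eq_abs, sq_abs, real_inner_comm]
  ring

theorem sub_one_le_norm_sub_smul {N : ℕ} {e y : Euc N} (he : ‖e‖ = 1) (hy : ‖y‖ = 1) {σ : ℝ}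
    (hσ : 1 ≤ σ) : σ - 1 ≤ ‖e - σ • y‖ := by
  apply le_of_sq_le_sq _ (norm_nonneg _)
  rw [norm_sub_smul_sq he hy]
  have : 0 ≤ σ * ‖y - e‖ ^ 2 := by positivity
  linarith

theorem norm_sub_le_norm_sub_smul {N : ℕ} {e y : Euc N} (he : ‖e‖ = 1) (hy : ‖y‖ = 1) {σ : ℝ}
    (hσ : 1 ≤ σ) : ‖y - e‖ ≤ ‖e - σ • y‖ := by
  apply le_of_sq_le_sq _ (norm_nonneg _)
  rw [norm_sub_smul_sq he hy]
  nlinarith [sq_nonneg (σ - 1), sq_nonneg ‖y - e‖]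

theorem sphereKernel_nonneg (N : ℕ) (p s : ℝ) (e : Euc N) (σ : ℝ) : 0 ≤ sphereKernel N p s e σ :=
  integral_nonneg fun _ => by positivity

theorem measurable_sphereKernel {N : ℕ} (hN : 2 ≤ N) (p s : ℝ) (e : Euc N) (he : ‖e‖ = 1) :
    Measurable (sphereKernel N p s e) := by
  have : IsFiniteMeasure ((μH[(N : ℝ) - 1] : Measure (Euc N)).restrict (sphere 0 1)) :=
    ⟨by simpa using sphere_measure_lt_top hN e he⟩
  have hm : Measurable fun q : ℝ × Euc N => ‖e - q.1 • q.2‖ ^ (-((N : ℝ) + p * s)) := by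
    fun_prop
  exact (hm.stronglyMeasurable.integral_prod_right
    (ν := (μH[(N : ℝ) - 1] : Measure (Euc N)).restrict (sphere 0 1))).measurable

theorem sphereKernel_le_far {N : ℕ} (hN : 2 ≤ N) {p s : ℝ} (hps : 0 < p * s) {e : Euc N}
    (he : ‖e‖ = 1) {σ : ℝ} (hσ : 1 < σ) :
    sphereKernel N p s e σ ≤ (σ - 1) ^ (-((N : ℝ) + p * s)) *
      (μH[(N : ℝ) - 1] : Measure (Euc N)).real (sphere 0 1) := by
  unfold sphereKernel
  refine (Real.le_norm_self _).trans
    (norm_setIntegral_le_of_norm_le_const (sphere_measure_lt_top hN e he) fun y hy => ?_)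
  rw [mem_sphere_zero_iff_norm] at hy
  rw [Real.norm_eq_abs, abs_of_nonneg (by positivity)]
  refine Real.rpow_le_rpow_of_nonpos (by linarith) (sub_one_le_norm_sub_smul he hy hσ.le) ?_
  have : (0 : ℝ) ≤ N := by positivity
  linarith

theorem sphereKernel_le_near {N : ℕ} (hN : 2 ≤ N) {p s : ℝ} (hps : 0 < p * s) {e : Euc N}
    (he : ‖e‖ = 1) :
    ∃ C : ℝ, 0 ≤ C ∧ ∀ σ : ℝ, 1 < σ →
      sphereKernel N p s e σ ≤ C * (σ - 1) ^ (-(1 + p * s)) := by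
  obtain ⟨C, hC, hA⟩ := ahlfors_sphere hN e he
  have hN' : (2 : ℝ) ≤ N := by exact_mod_cast hN
  set a : ℝ := N + p * s with ha
  have ha0 : 0 < a := by linarith
  set b : ℝ := ((N : ℝ) - 1) / a with hb
  have hb1 : b < 1 := by rw [hb, div_lt_one ha0]; linarith
  refine ⟨C / (1 - b), div_nonneg hC (by linarith), fun σ hσ => ?_⟩
  have hδ : 0 < σ - 1 := by linarith
  set M : ℝ := (σ - 1) ^ (-a) with hM
  have hM0 : 0 < M := by positivity
  have hmeas : Measurable fun y : Euc N => ‖e - σ • y‖ ^ (-a) := by fun_prop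
  have hint : IntervalIntegrable (fun t : ℝ => C * t ^ (-b)) volume 0 M :=
    (intervalIntegral.intervalIntegrable_rpow' (by linarith)).const_mul C
  have hval : ∫ t in (0)..M, C * t ^ (-b) = C / (1 - b) * (σ - 1) ^ (-(1 + p * s)) := by
    rw [intervalIntegral.integral_const_mul, integral_rpow (Or.inl (by linarith)),
      Real.zero_rpow (by linarith), hM, ← Real.rpow_mul hδ.le]
    have : -a * (-b + 1) = -(1 + p * s) := by
      rw [hb]; field_simp; rw [ha]; ring
    rw [this]
    ring
  unfold sphereKernel
  rw [integral_eq_lintegral_of_nonneg_ae (Eventually.of_forall fun y => by positivity)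
    hmeas.aestronglyMeasurable]
  refine ENNReal.toReal_le_of_le_ofReal (by
    have := div_nonneg hC (sub_nonneg.2 hb1.le)
    positivity) ?_
  rw [lintegral_eq_lintegral_meas_le _ (Eventually.of_forall fun y => by positivity)
    hmeas.aemeasurable, ← hval, intervalIntegral.integral_of_le hM0.le,
    ofReal_integral_eq_lintegral_ofReal ((intervalIntegrable_iff_integrableOn_Ioc_of_le hM0.le).1 hint)
    (by
      filter_upwards [ae_restrict_mem measurableSet_Ioc] with t ht
      have := ht.1
      positivity),
    ← lintegral_indicator measurableSet_Ioc, ← lintegral_indicator measurableSet_Ioi]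
  refine lintegral_mono fun t => ?_
  by_cases ht : t ∈ Ioi (0 : ℝ)
  swap
  · simp [indicator_of_notMem ht]
  rw [indicator_of_mem ht, Measure.restrict_apply (measurableSet_le measurable_const hmeas)]
  have ht0 : 0 < t := ht
  by_cases htM : t ≤ M
  · rw [indicator_of_mem (show t ∈ Ioc 0 M from ⟨ht0, htM⟩)]
    have hpow : t ^ (-b) = (t ^ (-a⁻¹)) ^ ((N : ℝ) - 1) := by
      rw [← Real.rpow_mul ht0.le]; congr 1; rw [hb]; field_simp
    rw [hpow]
    refine le_trans (measure_mono ?_) (hA (t ^ (-a⁻¹)) (by positivity))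
    rintro y ⟨hy1, hy2⟩
    refine ⟨hy2, ?_⟩
    rw [mem_sphere_zero_iff_norm] at hy2
    rw [mem_closedBall, dist_eq_norm]
    have hρ : 0 < ‖e - σ • y‖ := hδ.trans_le (sub_one_le_norm_sub_smul he hy2 hσ.le)
    refine (norm_sub_le_norm_sub_smul he hy2 hσ.le).trans ?_
    calc ‖e - σ • y‖ = (‖e - σ • y‖ ^ (-a)) ^ (-a⁻¹) := by
          rw [← Real.rpow_mul hρ.le, neg_mul_neg, mul_inv_cancel₀ ha0.ne', Real.rpow_one]
      _ ≤ t ^ (-a⁻¹) := Real.rpow_le_rpow_of_nonpos ht0 hy1 (by simp [ha0.le])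
  · have : {y : Euc N | t ≤ ‖e - σ • y‖ ^ (-a)} ∩ sphere 0 1 = ∅ := by
      rw [eq_empty_iff_forall_notMem]
      rintro y ⟨hy1, hy2⟩
      rw [mem_sphere_zero_iff_norm] at hy2
      exact htM (le_trans hy1 (Real.rpow_le_rpow_of_nonpos hδ
        (sub_one_le_norm_sub_smul he hy2 hσ.le) (by linarith)))
    rw [this]
    simp

theorem sphereKernel_inv {N : ℕ} (p s : ℝ) {e : Euc N} (he : ‖e‖ = 1) {σ : ℝ} (hσ : 0 < σ) :
    sphereKernel N p s e σ⁻¹ = σ ^ ((N : ℝ) + p * s) * sphereKernel N p s e σ := by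
  unfold sphereKernel
  rw [← integral_const_mul]
  refine setIntegral_congr_fun isClosed_sphere.measurableSet fun y hy => ?_
  rw [mem_sphere_zero_iff_norm] at hy
  have h : ‖e - σ⁻¹ • y‖ = σ⁻¹ * ‖e - σ • y‖ := by
    rw [← sq_eq_sq₀ (norm_nonneg _) (by positivity), mul_pow, norm_sub_smul_sq he hy,
      norm_sub_smul_sq he hy]
    field_simp
    ring
  simp only [h]
  rw [Real.mul_rpow (by positivity) (norm_nonneg _), Real.inv_rpow hσ.le, Real.rpow_neg hσ.le,
    inv_inv]

/-- The optimisation over `t = σ ^ η` at fixed `σ`, with optimum at `t = T`. -/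
theorem rpow_mul_sub_le {p : ℝ} (hp : 1 < p) {t T : ℝ} (ht : 1 ≤ t) (hT : 1 ≤ T) :
    (t - 1) ^ (p - 1) * (T ^ p * t ^ (-(p - 1)) - 1) ≤ (T - 1) ^ p := by
  rcases ht.eq_or_lt with rfl | ht
  · rw [sub_self, Real.zero_rpow (by linarith), zero_mul]
    exact Real.rpow_nonneg (by linarith) _
  have ht0 : 0 < t := by linarith
  have hl : 0 < 1 - 1 / t := by rw [sub_pos, div_lt_one ht0]; exact ht
  have hc := (convexOn_rpow hp.le).2 (x := (T - 1) / (1 - 1 / t)) (y := t)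
    (by simp only [mem_Ici]; exact div_nonneg (by linarith) hl.le) (by simpa using ht0.le)
    hl.le (by positivity : 0 ≤ 1 / t) (by ring)
  simp only [smul_eq_mul] at hc
  rw [mul_div_cancel₀ _ hl.ne', one_div_mul_cancel ht0.ne', sub_add_cancel,
    Real.div_rpow (by linarith) hl.le] at hc
  have hl' : 1 - 1 / t = (t - 1) / t := by field_simp
  have ht1 : 0 < t - 1 := by linarith
  have e1 : t ^ p = t * t ^ (p - 1) := by
    rw [← Real.rpow_one_add' ht0.le (by linarith)]; ring_nf
  have e2 : (t - 1) ^ p = (t - 1) * (t - 1) ^ (p - 1) := by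
    rw [← Real.rpow_one_add' ht1.le (by linarith)]; ring_nf
  rw [hl', Real.div_rpow ht1.le ht0.le, e1, e2] at hc
  rw [Real.rpow_neg ht0.le]
  have ha : 0 < (t - 1) ^ (p - 1) := by positivity
  have hb : 0 < t ^ (p - 1) := by positivity
  generalize (t - 1) ^ (p - 1) = A at *
  generalize t ^ (p - 1) = B at *
  have hc' : T ^ p ≤ B / A * (T - 1) ^ p + B := by
    refine hc.trans (le_of_eq ?_)
    field_simp
  have := mul_le_mul_of_nonneg_left hc' (div_pos ha hb).le
  have e3 : A / B * (B / A * (T - 1) ^ p + B) = (T - 1) ^ p + A := by field_simp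
  have e4 : A * (T ^ p * B⁻¹ - 1) = A / B * T ^ p - A := by field_simp
  linarith

theorem abs_rpow_sub_one_le (a : ℝ) :
    ∃ A : ℝ, 0 ≤ A ∧ ∀ σ ∈ Icc (1 : ℝ) 2, |σ ^ a - 1| ≤ A * (σ - 1) := by
  refine ⟨|a| * 2 ^ |a - 1|, by positivity, fun σ hσ => ?_⟩
  have := (convex_Icc (1 : ℝ) 2).norm_image_sub_le_of_norm_hasDerivWithin_le
    (f := fun x : ℝ => x ^ a) (f' := fun x => a * x ^ (a - 1)) (C := |a| * 2 ^ |a - 1|)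
    (fun x hx => (Real.hasDerivAt_rpow_const (Or.inl (by linarith [hx.1]))).hasDerivWithinAt)
    (fun x hx => by
      have hx0 : 0 < x := by linarith [hx.1]
      rw [norm_mul, Real.norm_eq_abs, Real.norm_eq_abs, abs_of_nonneg (Real.rpow_nonneg hx0.le _)]
      gcongr
      calc x ^ (a - 1) ≤ x ^ |a - 1| := Real.rpow_le_rpow_of_exponent_le hx.1 (le_abs_self _)
        _ ≤ 2 ^ |a - 1| := Real.rpow_le_rpow hx0.le hx.2 (abs_nonneg _))
    (left_mem_Icc.2 one_le_two) hσ
  simpa [Real.norm_eq_abs, abs_of_nonneg (sub_nonneg.2 hσ.1)] using this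

theorem measurable_thetaIntegrand {N : ℕ} (hN : 2 ≤ N) (p s η : ℝ) {e : Euc N} (he : ‖e‖ = 1) :
    Measurable (thetaIntegrand N p s η e) := by
  unfold thetaIntegrand
  have := measurable_sphereKernel hN p s e he
  fun_prop

theorem integrableOn_thetaIntegrand_near {N : ℕ} (hN : 2 ≤ N) {p s η : ℝ} (hs0 : 0 < s)
    (hs1 : s < 1) (hp1 : 1 < p) (hη : 0 ≤ η) {e : Euc N} (he : ‖e‖ = 1) :
    IntegrableOn (thetaIntegrand N p s η e) (Ioc 1 2) := by
  obtain ⟨C, hC, hK⟩ := sphereKernel_le_near hN (mul_pos (by linarith) hs0 : 0 < p * s) he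
  obtain ⟨A, hA, hA'⟩ := abs_rpow_sub_one_le η
  obtain ⟨B, hB, hB'⟩ := abs_rpow_sub_one_le ((N : ℝ) - 1 - η * (p - 1))
  obtain ⟨D, hD, hD'⟩ := abs_rpow_sub_one_le (p * s - 1)
  have hr : -1 < p - 1 - p * s := by nlinarith
  have hint : IntegrableOn (fun σ : ℝ => C * A ^ (p - 1) * (B + D) * (σ - 1) ^ (p - 1 - p * s))
      (Ioc 1 2) := by
    have h := ((intervalIntegral.intervalIntegrable_rpow' (a := 0) (b := 1) hr).comp_sub_right
      1).const_mul (C * A ^ (p - 1) * (B + D))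
    norm_num at h
    exact (intervalIntegrable_iff_integrableOn_Ioc_of_le one_le_two).1 h
  refine hint.mono' (measurable_thetaIntegrand hN p s η he).aestronglyMeasurable ?_
  filter_upwards [ae_restrict_mem measurableSet_Ioc] with σ hσ
  have hσ' : σ ∈ Icc (1 : ℝ) 2 := ⟨hσ.1.le, hσ.2⟩
  have hδ : 0 < σ - 1 := by linarith [hσ.1]
  have hη1 : 0 ≤ σ ^ η - 1 := sub_nonneg.2 (Real.one_le_rpow hσ'.1 hη)
  have h1 : (σ ^ η - 1) ^ (p - 1) ≤ (A * (σ - 1)) ^ (p - 1) :=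
    Real.rpow_le_rpow hη1 ((le_abs_self _).trans (hA' σ hσ')) (by linarith)
  have h2 : |σ ^ ((N : ℝ) - 1 - η * (p - 1)) - σ ^ (p * s - 1)| ≤ (B + D) * (σ - 1) := by
    have := abs_sub_le (σ ^ ((N : ℝ) - 1 - η * (p - 1))) 1 (σ ^ (p * s - 1))
    rw [abs_sub_comm 1] at this
    linarith [hB' σ hσ', hD' σ hσ']
  unfold thetaIntegrand
  rw [norm_mul, norm_mul, Real.norm_eq_abs, Real.norm_eq_abs, Real.norm_eq_abs,
    abs_of_nonneg (sphereKernel_nonneg ..), abs_of_nonneg (Real.rpow_nonneg hη1 _)]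
  calc _ ≤ C * (σ - 1) ^ (-(1 + p * s)) * (A * (σ - 1)) ^ (p - 1) * ((B + D) * (σ - 1)) := by
        gcongr
        exact hK σ hσ.1
    _ = C * A ^ (p - 1) * (B + D) *
          ((σ - 1) ^ (-(1 + p * s)) * (σ - 1) ^ (p - 1) * (σ - 1) ^ (1 : ℝ)) := by
        rw [Real.mul_rpow hA hδ.le, Real.rpow_one]; ring
    _ = _ := by
        rw [← Real.rpow_add hδ, ← Real.rpow_add hδ]; congr 2; ring

theorem integrableOn_thetaIntegrand_far {N : ℕ} (hN : 2 ≤ N) {p s η : ℝ} (hs0 : 0 < s)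
    (hp1 : 1 < p) (hη : 0 ≤ η) (hηN : η * (p - 1) < N) {e : Euc N} (he : ‖e‖ = 1) :
    IntegrableOn (thetaIntegrand N p s η e) (Ioi 2) := by
  have hps : 0 < p * s := mul_pos (by linarith) hs0
  set m := (μH[(N : ℝ) - 1] : Measure (Euc N)).real (sphere 0 1) with hm
  have hm0 : 0 ≤ m := measureReal_nonneg
  set a : ℝ := N + p * s with ha
  have ha0 : 0 < a := by positivity
  have hint : IntegrableOn (fun σ : ℝ => 2 ^ a * m *
      (σ ^ (-1 - p * s) + σ ^ (-1 - (N - η * (p - 1))))) (Ioi 2) := by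
    refine Integrable.const_mul (Integrable.add ?_ ?_) _
    · exact integrableOn_Ioi_rpow_of_lt (by linarith) two_pos
    · exact integrableOn_Ioi_rpow_of_lt (by linarith) two_pos
  have hNps : -1 - (N - η * (p - 1)) = -a + η * (p - 1) + (p * s - 1) := by rw [ha]; ring
  have hps' : -1 - p * s = -a + η * (p - 1) + ((N : ℝ) - 1 - η * (p - 1)) := by rw [ha]; ring
  refine hint.mono' (measurable_thetaIntegrand hN p s η he).aestronglyMeasurable ?_
  filter_upwards [ae_restrict_mem measurableSet_Ioi] with σ hσ
  have hσ2 : 2 < σ := hσ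
  have hσ0 : 0 < σ := by linarith
  have hη1 : 0 ≤ σ ^ η - 1 := sub_nonneg.2 (Real.one_le_rpow (by linarith) hη)
  have hK : sphereKernel N p s e σ ≤ 2 ^ a * m * σ ^ (-a) :=
    calc _ ≤ (σ - 1) ^ (-a) * m := sphereKernel_le_far hN hps he (by linarith)
      _ ≤ (σ / 2) ^ (-a) * m := by
          gcongr ?_ * _
          exact Real.rpow_le_rpow_of_nonpos (by linarith) (by linarith) (by linarith)
      _ = _ := by
          rw [Real.div_rpow hσ0.le two_pos.le, Real.rpow_neg two_pos.le, div_inv_eq_mul]; ring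
  have h1 : (σ ^ η - 1) ^ (p - 1) ≤ σ ^ (η * (p - 1)) := by
    rw [Real.rpow_mul hσ0.le]
    exact Real.rpow_le_rpow hη1 (by linarith) (by linarith)
  have h2 : |σ ^ ((N : ℝ) - 1 - η * (p - 1)) - σ ^ (p * s - 1)| ≤
      σ ^ ((N : ℝ) - 1 - η * (p - 1)) + σ ^ (p * s - 1) := by
    have u := Real.rpow_pos_of_pos hσ0 ((N : ℝ) - 1 - η * (p - 1))
    have v := Real.rpow_pos_of_pos hσ0 (p * s - 1)
    rw [abs_le]
    constructor <;> linarith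
  unfold thetaIntegrand
  rw [norm_mul, norm_mul, Real.norm_eq_abs, Real.norm_eq_abs, Real.norm_eq_abs,
    abs_of_nonneg (sphereKernel_nonneg ..), abs_of_nonneg (Real.rpow_nonneg hη1 _)]
  calc _ ≤ 2 ^ a * m * σ ^ (-a) * σ ^ (η * (p - 1)) *
          (σ ^ ((N : ℝ) - 1 - η * (p - 1)) + σ ^ (p * s - 1)) := by
        gcongr
    _ = _ := by
        rw [hNps, hps', Real.rpow_add hσ0 (-a + _), Real.rpow_add hσ0 (-a + _),
          Real.rpow_add hσ0 (-a)]
        ring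

theorem integrableOn_thetaIntegrand {N : ℕ} (hN : 2 ≤ N) {p s η : ℝ} (hs0 : 0 < s)
    (hs1 : s < 1) (hp1 : 1 < p) (hη : 0 ≤ η) (hηN : η * (p - 1) < N) {e : Euc N} (he : ‖e‖ = 1) :
    IntegrableOn (thetaIntegrand N p s η e) (Ioi 1) := by
  rw [← Ioc_union_Ioi_eq_Ioi one_le_two]
  exact (integrableOn_thetaIntegrand_near hN hs0 hs1 hp1 hη he).union
    (integrableOn_thetaIntegrand_far hN hs0 hp1 hη hηN he)

theorem thetaIntegrand_eq {N : ℕ} {p s η : ℝ} (hp : 0 < p) (e : Euc N) {σ : ℝ} (hσ : 0 < σ) :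
    thetaIntegrand N p s η e σ = sphereKernel N p s e σ * σ ^ (p * s - 1) *
      ((σ ^ η - 1) ^ (p - 1) *
        ((σ ^ (((N : ℝ) - p * s) / p)) ^ p * (σ ^ η) ^ (-(p - 1)) - 1)) := by
  have h : σ ^ ((N : ℝ) - 1 - η * (p - 1)) = σ ^ (p * s - 1) *
      ((σ ^ (((N : ℝ) - p * s) / p)) ^ p * (σ ^ η) ^ (-(p - 1))) := by
    rw [← Real.rpow_mul hσ.le, ← Real.rpow_mul hσ.le, ← Real.rpow_add hσ, ← Real.rpow_add hσ,
      div_mul_cancel₀ _ hp.ne']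
    congr 1
    ring
  rw [thetaIntegrand, h]
  ring

theorem thetaIntegrand_optimal {N : ℕ} {p s : ℝ} (hp : 1 < p) (hps : p * s < N) (e : Euc N)
    {σ : ℝ} (hσ : 1 < σ) :
    thetaIntegrand N p s (((N : ℝ) - p * s) / p) e σ = sphereKernel N p s e σ * σ ^ (p * s - 1) *
      (σ ^ (((N : ℝ) - p * s) / p) - 1) ^ p := by
  rw [thetaIntegrand_eq (by linarith) e (by linarith)]
  have hT : 1 < σ ^ (((N : ℝ) - p * s) / p) :=
    Real.one_lt_rpow hσ (div_pos (by linarith) (by linarith))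
  generalize σ ^ (((N : ℝ) - p * s) / p) = T at *
  have hT0 : 0 < T := by linarith
  congr 1
  rw [← Real.rpow_add hT0, show p + -(p - 1) = 1 by ring, Real.rpow_one,
    ← Real.rpow_add_one (by linarith), sub_add_cancel]

theorem theta_optimal {N : ℕ} {p s : ℝ} (hp : 1 < p) (hps : p * s < N) {e : Euc N}
    (he : ‖e‖ = 1) :
    theta N p s (((N : ℝ) - p * s) / p) e = hardyConst N p s e := by
  have himg : (fun x : ℝ => x⁻¹) '' Ioo 0 1 = Ioi 1 := by
    ext x
    constructor
    · rintro ⟨y, hy, rfl⟩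
      exact (one_lt_inv₀ hy.1).2 hy.2
    · intro hx
      have hx1 : 1 < x := hx
      exact ⟨x⁻¹, ⟨by positivity, inv_lt_one_of_one_lt₀ hx1⟩, inv_inv x⟩
  unfold theta hardyConst
  rw [← himg, integral_image_eq_integral_abs_deriv_smul measurableSet_Ioo
    (fun x hx => (hasDerivAt_inv hx.1.ne').hasDerivWithinAt) inv_injective.injOn]
  refine setIntegral_congr_fun measurableSet_Ioo fun σ hσ => ?_
  have hσ0 : 0 < σ := hσ.1
  have hp0 : 0 < p := by linarith
  rw [thetaIntegrand_optimal hp hps e ((one_lt_inv₀ hσ0).2 hσ.2), sphereKernel_inv p s he hσ0,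
    Real.inv_rpow hσ0.le, Real.inv_rpow hσ0.le]
  have hT0 : 0 < σ ^ (((N : ℝ) - p * s) / p) := Real.rpow_pos_of_pos hσ0 _
  have hT1 : σ ^ (((N : ℝ) - p * s) / p) ≤ 1 :=
    Real.rpow_le_one hσ0.le hσ.2.le (div_nonneg (by linarith) hp0.le)
  have hTp : (σ ^ (((N : ℝ) - p * s) / p)) ^ p = σ ^ ((N : ℝ) - p * s) := by
    rw [← Real.rpow_mul hσ0.le, div_mul_cancel₀ _ hp0.ne']
  have h1 : (σ ^ (((N : ℝ) - p * s) / p))⁻¹ - 1 =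
      (1 - σ ^ (((N : ℝ) - p * s) / p)) / σ ^ (((N : ℝ) - p * s) / p) := by
    field_simp
  rw [h1, Real.div_rpow (by linarith) hT0.le, hTp, abs_neg, abs_of_pos (by positivity),
    smul_eq_mul]
  have h2 : σ ^ ((N : ℝ) + p * s) =
      σ ^ (p * s - 1) * σ ^ (p * s - 1) * σ ^ ((N : ℝ) - p * s) * σ ^ 2 := by
    rw [← Real.rpow_natCast σ 2, ← Real.rpow_add hσ0, ← Real.rpow_add hσ0, ← Real.rpow_add hσ0]
    congr 1
    push_cast
    ring
  rw [h2]
  have := Real.rpow_pos_of_pos hσ0 (p * s - 1)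
  have := Real.rpow_pos_of_pos hσ0 ((N : ℝ) - p * s)
  field_simp

/-- **Properties of `Θ`.** For each `η ≥ 0` with `η(p-1) < N` the integral `Θ(η)` converges;
`Θ(0) = 0`; `Θ` attains its maximum `Λ_{N,p,s}` at `η = (N-ps)/p`. -/
theorem theta_properties (N : ℕ) (hN : 2 ≤ N) (s p : ℝ)
    (hs0 : 0 < s) (hs1 : s < 1) (hp1 : 1 < p) (hps : p * s < N)
    (e : Euc N) (he : ‖e‖ = 1) :
    (∀ η : ℝ, 0 ≤ η → η * (p - 1) < N →
        IntegrableOn (thetaIntegrand N p s η e) (Set.Ioi 1) volume) ∧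
      theta N p s 0 e = 0 ∧
      theta N p s (((N : ℝ) - p * s) / p) e = hardyConst N p s e ∧
      ∀ η : ℝ, 0 ≤ η → η * (p - 1) < N → theta N p s η e ≤ hardyConst N p s e := by

  have hp0 : 0 < p := by linarith
  have hη₀ : 0 ≤ ((N : ℝ) - p * s) / p := div_nonneg (by linarith) hp0.le
  have hη₀N : ((N : ℝ) - p * s) / p * (p - 1) < N := by
    rw [div_mul_eq_mul_div, div_lt_iff₀ hp0]
    nlinarith [mul_pos hp0 hs0]
  refine ⟨fun η hη hηN => integrableOn_thetaIntegrand hN hs0 hs1 hp1 hη hηN he, ?_,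
    theta_optimal hp1 hps he, fun η hη hηN => ?_⟩
  · have h : thetaIntegrand N p s 0 e = 0 := by
      funext σ
      simp [thetaIntegrand, Real.zero_rpow (sub_pos.2 hp1).ne']
    simp [theta, h]
  · rw [← theta_optimal hp1 hps he]
    refine setIntegral_mono_on (integrableOn_thetaIntegrand hN hs0 hs1 hp1 hη hηN he)
      (integrableOn_thetaIntegrand hN hs0 hs1 hp1 hη₀ hη₀N he) measurableSet_Ioi fun σ hσ => ?_
    have hσ1 : 1 < σ := hσ
    have hσ0 : 0 < σ := by linarith
    rw [thetaIntegrand_optimal hp1 hps e hσ1, thetaIntegrand_eq hp0 e hσ0]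
    exact mul_le_mul_of_nonneg_left
      (rpow_mul_sub_le hp1 (Real.one_le_rpow hσ1.le hη) (Real.one_le_rpow hσ1.le hη₀))
      (mul_nonneg (sphereKernel_nonneg ..) (Real.rpow_nonneg hσ0.le _))
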